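/- As |ρ| → 1 (with ρ ∈ (−1, 1), ρ ≠ 0), each of the three quantities A*(ρ), A*_S(ρ) and A*_H(ρ), divided by 2·log((ρ^{−2} − 1)^{−1}), converges to 1; that is, lim_{|ρ|↑1} A*(ρ)/(2 log((ρ^{−2}−1)^{−1})) = lim_{|ρ|↑1} A*_S(ρ)/(2 log((ρ^{−2}−1)^{−1})) = lim_{|ρ|↑1} A*_H(ρ)/(2 log((ρ^{−2}−1)^{−1})) = 1. -/

import Mathlib

open MeasureTheory ProbabilityTheory Filter
open scoped ENNReal Topology

/-- Gaussian shift risk: `r(δ, μ) = E_{T ~ N(μ,1)}[(δ(T) − μ)²]`, valued in `[0,∞]`. -/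
noncomputable def gShiftRisk (δ : ℝ → ℝ) (μ : ℝ) : ℝ≥0∞ :=
  ∫⁻ t, ENNReal.ofReal ((δ t - μ) ^ 2) ∂(gaussianReal μ 1)

/-- Bounded normal mean minimax risk for a real bound `τ ≥ 0`:
`r^BNM(τ) = inf_{δ measurable} sup_{μ ∈ [−τ, τ]} r(δ, μ)`. -/
noncomputable def rBNM (τ : ℝ) : ℝ≥0∞ :=
  ⨅ δ : {f : ℝ → ℝ // Measurable f}, ⨆ μ ∈ Set.Icc (-τ) τ, gShiftRisk δ μ

/-- The adaptation objective
`A(δ̃, ρ) = sup_{b̃ ∈ ℝ} (r(δ̃, b̃) + ρ⁻² − 1)/(r^BNM(|b̃|) + ρ⁻² − 1)`. -/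
noncomputable def adaptObj (ρ : ℝ) (δ : ℝ → ℝ) : ℝ≥0∞ :=
  ⨆ b : ℝ, (gShiftRisk δ b + ENNReal.ofReal ((ρ ^ 2)⁻¹ - 1)) /
    (rBNM |b| + ENNReal.ofReal ((ρ ^ 2)⁻¹ - 1))

/-- Soft-thresholding estimator `δ_{S,λ}(t) = sign(t)·max{|t| − λ, 0}`. -/
noncomputable def softThresh (l t : ℝ) : ℝ := Real.sign t * max (|t| - l) 0

/-- Hard-thresholding estimator `δ_{H,λ}(t) = t·1{|t| > λ}`. -/
noncomputable def hardThresh (l t : ℝ) : ℝ := if l < |t| then t else 0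

/-- Loss of efficiency under adaptation `A*(ρ) = inf_{δ̃ measurable} A(δ̃, ρ)`. -/
noncomputable def Astar (ρ : ℝ) : ℝ≥0∞ :=
  ⨅ δ : {f : ℝ → ℝ // Measurable f}, adaptObj ρ δ

/-- Minimal worst-case adaptation regret over soft-thresholding estimators. -/
noncomputable def AstarS (ρ : ℝ) : ℝ≥0∞ :=
  ⨅ l ∈ Set.Ici (0 : ℝ), adaptObj ρ (softThresh l)

/-- Minimal worst-case adaptation regret over hard-thresholding estimators. -/
noncomputable def AstarH (ρ : ℝ) : ℝ≥0∞ :=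
  ⨅ l ∈ Set.Ici (0 : ℝ), adaptObj ρ (hardThresh l)

/-- The normalization `2·log((ρ⁻² − 1)⁻¹)`, as an extended nonnegative real. -/
noncomputable def denomLog (ρ : ℝ) : ℝ≥0∞ :=
  ENNReal.ofReal (2 * Real.log (((ρ ^ 2)⁻¹ - 1)⁻¹))

/-- The filter of `ρ` with `|ρ| → 1` from below (eventually `ρ ∈ (−1,1)` and `ρ ≠ 0`). -/
noncomputable def rhoFilter : Filter ℝ :=
  Filter.comap (fun ρ : ℝ => |ρ|) (𝓝[<] (1 : ℝ))

lemma lintegral_gaussianReal_comp_sub (b : ℝ) {f : ℝ → ℝ≥0∞} (hf : Measurable f) :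
    ∫⁻ t, f (t - b) ∂(gaussianReal b 1) = ∫⁻ z, f z ∂(gaussianReal 0 1) := by
  rw [← lintegral_map hf (g := fun t => t - b) (by fun_prop)]
  simp [gaussianReal_map_sub_const]

lemma lintegral_gaussianReal_eq_comp_add (b : ℝ) {f : ℝ → ℝ≥0∞} (hf : Measurable f) :
    ∫⁻ t, f t ∂(gaussianReal b 1) = ∫⁻ z, f (z + b) ∂(gaussianReal 0 1) := by
  rw [← lintegral_gaussianReal_comp_sub b (f := fun z => f (z + b)) (by fun_prop)]
  simp

lemma lintegral_gaussianReal_eq_pdf (b : ℝ) {f : ℝ → ℝ≥0∞} (hf : Measurable f) :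
    ∫⁻ t, f t ∂(gaussianReal b 1) =
      ∫⁻ t, ENNReal.ofReal ((√(2 * Real.pi))⁻¹ * Real.exp (-(t - b) ^ 2 / 2)) * f t := by
  rw [gaussianReal_of_var_ne_zero b one_ne_zero,
    lintegral_withDensity_eq_lintegral_mul _ (measurable_gaussianPDF b 1) hf]
  simp [gaussianPDF, gaussianPDFReal]

lemma gShiftRisk_id (μ : ℝ) : gShiftRisk (fun t => t) μ = 1 := by
  have h := evariance_eq_lintegral_ofReal (X := fun x : ℝ => x) (μ := gaussianReal μ 1)
  rw [integral_id_gaussianReal] at h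
  rw [gShiftRisk, ← h, ← MemLp.ofReal_variance_eq, variance_fun_id_gaussianReal]
  · simp
  · exact memLp_id_gaussianReal 2

lemma lintegral_sq_gaussianReal :
    ∫⁻ z, ENNReal.ofReal (z ^ 2) ∂(gaussianReal 0 1) = 1 := by
  simpa [gShiftRisk] using gShiftRisk_id 0

lemma rBNM_le_one (τ : ℝ) : rBNM τ ≤ 1 :=
  (iInf_le _ ⟨fun t => t, measurable_id⟩).trans
    (iSup₂_le fun μ _ => (gShiftRisk_id μ).le)

lemma rBNM_zero : rBNM 0 = 0 := by
  refine le_antisymm ((iInf_le _ ⟨fun _ => 0, measurable_const⟩).trans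
    (iSup₂_le fun μ hμ => ?_)) zero_le
  obtain rfl : μ = 0 := by simpa using hμ
  simp [gShiftRisk]

lemma rBNM_mono {σ τ : ℝ} (h : σ ≤ τ) : rBNM σ ≤ rBNM τ :=
  iInf_mono fun _ => biSup_mono fun _ hμ => Set.Icc_subset_Icc (neg_le_neg h) h hμ

/-- Two-point prior bound: `r^BNM(τ)` is at least a constant multiple of `τ²` on bounded sets. -/
lemma exists_mul_sq_le_rBNM (K : ℝ) :
    ∃ m : ℝ, 0 < m ∧ ∀ τ, 0 ≤ τ → τ ≤ K → ENNReal.ofReal (m * τ ^ 2) ≤ rBNM τ := by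
  set m : ℝ := (√(2 * Real.pi))⁻¹ * Real.exp (-(1 + K) ^ 2 / 2) with hm
  have hm0 : 0 < m := by positivity
  refine ⟨m, hm0, fun τ h0 hK => le_iInf fun ⟨δ, hδ⟩ => ?_⟩
  set S := ⨆ μ ∈ Set.Icc (-τ) τ, gShiftRisk δ μ
  have key : ∀ b ∈ Set.Icc (-τ) τ,
      ∫⁻ t in Set.Icc (0 : ℝ) 1, ENNReal.ofReal (m * (δ t - b) ^ 2) ≤ S := by
    intro b hb
    refine le_trans ?_ (le_iSup₂ (f := fun μ (_ : μ ∈ Set.Icc (-τ) τ) => gShiftRisk δ μ) b hb)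
    rw [gShiftRisk, lintegral_gaussianReal_eq_pdf b (by fun_prop)]
    refine le_trans (setLIntegral_mono' measurableSet_Icc fun t ht => ?_)
      (setLIntegral_le_lintegral (Set.Icc (0 : ℝ) 1) _)
    rw [ENNReal.ofReal_mul hm0.le]
    gcongr
    simp only [Set.mem_Icc] at hb ht
    have : (t - b) ^ 2 ≤ (1 + K) ^ 2 := sq_le_sq' (by linarith) (by linarith)
    rw [hm]
    gcongr
  have h2 : 2 * ENNReal.ofReal (m * τ ^ 2) ≤ 2 * S := by
    calc 2 * ENNReal.ofReal (m * τ ^ 2)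
        = ∫⁻ _ in Set.Icc (0 : ℝ) 1, 2 * ENNReal.ofReal (m * τ ^ 2) := by simp
      _ ≤ ∫⁻ t in Set.Icc (0 : ℝ) 1, (ENNReal.ofReal (m * (δ t - τ) ^ 2) +
            ENNReal.ofReal (m * (δ t - -τ) ^ 2)) := by
          refine lintegral_mono fun t => ?_
          rw [← ENNReal.ofReal_add (by positivity) (by positivity),
            show (2 : ℝ≥0∞) = ENNReal.ofReal 2 by simp, ← ENNReal.ofReal_mul (by norm_num)]
          apply ENNReal.ofReal_le_ofReal
          nlinarith [mul_nonneg hm0.le (sq_nonneg (δ t))]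
      _ = _ := lintegral_add_left (by fun_prop) _
      _ ≤ S + S := add_le_add (key τ ⟨by linarith, le_rfl⟩) (key (-τ) ⟨le_rfl, by linarith⟩)
      _ = 2 * S := (two_mul S).symm
  exact (ENNReal.mul_le_mul_iff_right (by simp) (by simp)).1 h2

/-- Among shifts, the truncated second moment of a standard Gaussian is smallest at the origin. -/
lemma setLIntegral_sq_le_shift (M a : ℝ) :
    ∫⁻ z in Set.Icc (-M) M, ENNReal.ofReal (z ^ 2) ∂(gaussianReal 0 1) ≤
      ∫⁻ z in Set.Icc (-M) M, ENNReal.ofReal ((a + z) ^ 2) ∂(gaussianReal 0 1) := by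
  have hneg : MeasurePreserving (fun x : ℝ => -x) (gaussianReal 0 1) (gaussianReal 0 1) :=
    ⟨measurable_neg, by simp [gaussianReal_map_neg]⟩
  have hsymm := hneg.setLIntegral_comp_preimage (s := Set.Icc (-M) M) measurableSet_Icc
    (f := fun z => ENNReal.ofReal ((a + z) ^ 2)) (by fun_prop)
  have hpre : (fun x : ℝ => -x) ⁻¹' Set.Icc (-M) M = Set.Icc (-M) M := by
    ext x; simp only [Set.mem_preimage, Set.mem_Icc]; constructor <;> intro h <;>
      constructor <;> linarith [h.1, h.2]
  rw [hpre] at hsymm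
  refine (ENNReal.mul_le_mul_iff_right (a := 2) (by simp) (by simp)).1 ?_
  rw [two_mul (∫⁻ z in _, ENNReal.ofReal ((a + z) ^ 2) ∂_)]
  nth_rewrite 1 [← hsymm]
  rw [← lintegral_add_left (by fun_prop), ← lintegral_const_mul _ (by fun_prop)]
  refine lintegral_mono fun z => ?_
  rw [← ENNReal.ofReal_add (by positivity) (by positivity),
    show (2 : ℝ≥0∞) = ENNReal.ofReal 2 by simp, ← ENNReal.ofReal_mul (by norm_num)]
  apply ENNReal.ofReal_le_ofReal
  nlinarith [sq_nonneg a]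

/-- Uniform prior bound on `[-τ, τ]`. -/
lemma uniform_prior_le_rBNM {M τ : ℝ} (hM : 0 ≤ M) (hτ : M ≤ τ) :
    ENNReal.ofReal (2 * (τ - M)) *
        ∫⁻ z in Set.Icc (-M) M, ENNReal.ofReal (z ^ 2) ∂(gaussianReal 0 1) ≤
      rBNM τ * ENNReal.ofReal (2 * τ) := by
  set V := ∫⁻ z in Set.Icc (-M) M, ENNReal.ofReal (z ^ 2) ∂(gaussianReal 0 1)
  rcases (hM.trans hτ).eq_or_lt with h | hpos
  · simp [← h, (by linarith : M = 0)]
  refine (ENNReal.div_le_iff (by simpa using hpos) ENNReal.ofReal_ne_top).1 (le_iInf fun ⟨δ, hδ⟩ => ?_)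
  refine ENNReal.div_le_of_le_mul ?_
  set S := ⨆ μ ∈ Set.Icc (-τ) τ, gShiftRisk δ μ
  calc ENNReal.ofReal (2 * (τ - M)) * V
      = ∫⁻ _ in Set.Icc (-(τ - M)) (τ - M), V := by
        rw [setLIntegral_const, Real.volume_Icc, mul_comm]; ring_nf
    _ ≤ ∫⁻ t in Set.Icc (-(τ - M)) (τ - M), ∫⁻ z in Set.Icc (-M) M,
          ENNReal.ofReal ((δ t - t + z) ^ 2) ∂(gaussianReal 0 1) :=
        lintegral_mono fun t => setLIntegral_sq_le_shift M _
    _ = ∫⁻ z in Set.Icc (-M) M, ∫⁻ t in Set.Icc (-(τ - M)) (τ - M),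
          ENNReal.ofReal ((δ t - t + z) ^ 2) ∂volume ∂(gaussianReal 0 1) :=
        lintegral_lintegral_swap (by fun_prop)
    _ ≤ ∫⁻ z in Set.Icc (-M) M, ∫⁻ μ in Set.Icc (-τ) τ,
          ENNReal.ofReal ((δ (z + μ) - μ) ^ 2) ∂volume ∂(gaussianReal 0 1) := by
        refine setLIntegral_mono' measurableSet_Icc fun z hz => ?_
        rw [← (measurePreserving_add_left volume z).setLIntegral_comp_preimage
          measurableSet_Icc (by fun_prop)]
        refine le_trans (lintegral_mono_set fun μ hμ => ?_)
          (le_of_eq (lintegral_congr fun μ => by ring_nf))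
        simp only [Set.mem_preimage, Set.mem_Icc] at hμ hz ⊢
        constructor <;> linarith
    _ ≤ ∫⁻ z, ∫⁻ μ in Set.Icc (-τ) τ,
          ENNReal.ofReal ((δ (z + μ) - μ) ^ 2) ∂volume ∂(gaussianReal 0 1) :=
        setLIntegral_le_lintegral _ _
    _ = ∫⁻ μ in Set.Icc (-τ) τ, ∫⁻ z,
          ENNReal.ofReal ((δ (z + μ) - μ) ^ 2) ∂(gaussianReal 0 1) :=
        lintegral_lintegral_swap (by fun_prop)
    _ = ∫⁻ μ in Set.Icc (-τ) τ, gShiftRisk δ μ := by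
        refine lintegral_congr fun μ => ?_
        rw [gShiftRisk, lintegral_gaussianReal_eq_comp_add μ (by fun_prop)]
    _ ≤ ∫⁻ _ in Set.Icc (-τ) τ, S :=
        setLIntegral_mono' measurableSet_Icc fun μ hμ =>
          le_iSup₂ (f := fun μ (_ : μ ∈ Set.Icc (-τ) τ) => gShiftRisk δ μ) μ hμ
    _ = S * ENNReal.ofReal (2 * τ) := by
        rw [setLIntegral_const, Real.volume_Icc]; ring_nf

/-- Large symmetric intervals carry almost all of an integral. -/
lemma exists_lt_setLIntegral_Icc {ν : Measure ℝ} {f : ℝ → ℝ≥0∞} {c : ℝ≥0∞}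
    (hc : c < ∫⁻ z, f z ∂ν) :
    ∃ M : ℝ, 0 < M ∧ c < ∫⁻ z in Set.Icc (-M) M, f z ∂ν := by
  have hU : (⋃ n : ℕ, Set.Icc (-((n : ℝ) + 1)) ((n : ℝ) + 1)) = Set.univ := by
    refine Set.eq_univ_of_forall fun x => Set.mem_iUnion.2 ?_
    obtain ⟨n, hn⟩ := exists_nat_ge |x|
    exact ⟨n, abs_le.1 (by linarith)⟩
  have hmono : Monotone fun n : ℕ => Set.Icc (-((n : ℝ) + 1)) ((n : ℝ) + 1) := fun i j hij => by
    have : (i : ℝ) ≤ j := by exact_mod_cast hij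
    exact Set.Icc_subset_Icc (by linarith) (by linarith)
  rw [← setLIntegral_univ, ← hU, setLIntegral_iUnion_of_directed f hmono.directed_le] at hc
  obtain ⟨n, hn⟩ := lt_iSup_iff.1 hc
  exact ⟨n + 1, by positivity, hn⟩

lemma exists_le_rBNM {c : ℝ} (h0 : 0 < c) (h1 : c < 1) :
    ∃ K : ℝ, 0 < K ∧ ENNReal.ofReal c ≤ rBNM K := by
  have hs1 : √c < 1 := by rw [Real.sqrt_lt' one_pos]; simpa
  have hlt : ENNReal.ofReal √c < ∫⁻ z, ENNReal.ofReal (z ^ 2) ∂(gaussianReal 0 1) := by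
    rw [lintegral_sq_gaussianReal]; simpa using hs1
  obtain ⟨M, hM, hV⟩ := exists_lt_setLIntegral_Icc hlt
  set K := M / (1 - √c) with hK
  have hden : 0 < 1 - √c := by linarith
  have hKM : K * (1 - √c) = M := by rw [hK]; field_simp
  have hKpos : 0 < K := by positivity
  refine ⟨K, hKpos, ?_⟩
  have hMK : M ≤ K := by nlinarith [Real.sqrt_nonneg c]
  have h := uniform_prior_le_rBNM hM.le hMK
  refine (ENNReal.mul_le_mul_iff_left (c := ENNReal.ofReal (2 * K)) (by simpa using hKpos)
    ENNReal.ofReal_ne_top).1 (le_trans ?_ h)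
  calc ENNReal.ofReal c * ENNReal.ofReal (2 * K)
      = ENNReal.ofReal (2 * (K - M)) * ENNReal.ofReal √c := by
        rw [← ENNReal.ofReal_mul h0.le, ← ENNReal.ofReal_mul (by linarith)]
        congr 1
        nlinarith [Real.mul_self_sqrt h0.le]
    _ ≤ _ := by gcongr

/-- Two-point lower bound: an estimator with small risk at `0` has large risk at `b`. -/
lemma sq_mul_le_gShiftRisk_add {δ : ℝ → ℝ} (hδ : Measurable δ) {b x κ : ℝ} (hb : 0 ≤ b)
    (h0 : 0 < κ) :
    ENNReal.ofReal ((1 - κ) * b ^ 2) * gaussianReal 0 1 (Set.Iic x) ≤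
      gShiftRisk δ b +
        ENNReal.ofReal (κ⁻¹ * Real.exp (b ^ 2 / 2 + b * x)) * gShiftRisk δ 0 := by
  have hP : gaussianReal 0 1 (Set.Iic x) = gaussianReal b 1 (Set.Iic (b + x)) := by
    have h := gaussianReal_map_sub_const (μ := b) (v := 1) b
    rw [sub_self] at h
    rw [← h, Measure.map_apply (by fun_prop) measurableSet_Iic]
    congr 1
    ext t
    simp [add_comm]
  have hpt : ∀ d : ℝ, (1 - κ) * b ^ 2 ≤ (d - b) ^ 2 + κ⁻¹ * d ^ 2 := fun d => by
    have e : (d - b) ^ 2 + κ⁻¹ * d ^ 2 - (1 - κ) * b ^ 2 =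
        d ^ 2 + κ⁻¹ * (d - κ * b) ^ 2 := by field_simp; ring
    have : 0 ≤ d ^ 2 + κ⁻¹ * (d - κ * b) ^ 2 := by positivity
    linarith
  have htail : ∫⁻ t in Set.Iic (b + x), ENNReal.ofReal (κ⁻¹ * δ t ^ 2) ∂(gaussianReal b 1) ≤
      ENNReal.ofReal (κ⁻¹ * Real.exp (b ^ 2 / 2 + b * x)) * gShiftRisk δ 0 := by
    rw [← lintegral_indicator measurableSet_Iic, lintegral_gaussianReal_eq_pdf b
      ((by fun_prop : Measurable fun t => ENNReal.ofReal (κ⁻¹ * δ t ^ 2)).indicator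
        measurableSet_Iic), gShiftRisk, lintegral_gaussianReal_eq_pdf 0 (by fun_prop),
      ← lintegral_const_mul _ (by fun_prop)]
    refine lintegral_mono fun t => ?_
    by_cases ht : t ∈ Set.Iic (b + x)
    · rw [Set.indicator_of_mem ht, ← ENNReal.ofReal_mul (by positivity),
        ← ENNReal.ofReal_mul (by positivity), ← ENNReal.ofReal_mul (by positivity)]
      refine ENNReal.ofReal_le_ofReal ?_
      have he : Real.exp (-(t - b) ^ 2 / 2) ≤
          Real.exp (b ^ 2 / 2 + b * x) * Real.exp (-(t - 0) ^ 2 / 2) := by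
        rw [← Real.exp_add, Real.exp_le_exp]
        nlinarith [mul_le_mul_of_nonneg_left (Set.mem_Iic.1 ht) hb]
      calc _ = (√(2 * Real.pi))⁻¹ * κ⁻¹ * δ t ^ 2 * Real.exp (-(t - b) ^ 2 / 2) := by ring
        _ ≤ (√(2 * Real.pi))⁻¹ * κ⁻¹ * δ t ^ 2 *
            (Real.exp (b ^ 2 / 2 + b * x) * Real.exp (-(t - 0) ^ 2 / 2)) := by gcongr
        _ = _ := by ring
    · simp [Set.indicator_of_notMem ht]
  calc ENNReal.ofReal ((1 - κ) * b ^ 2) * gaussianReal 0 1 (Set.Iic x)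
      = ∫⁻ _ in Set.Iic (b + x), ENNReal.ofReal ((1 - κ) * b ^ 2) ∂(gaussianReal b 1) := by
        rw [setLIntegral_const, hP]
    _ ≤ ∫⁻ t in Set.Iic (b + x), (ENNReal.ofReal ((δ t - b) ^ 2) +
          ENNReal.ofReal (κ⁻¹ * δ t ^ 2)) ∂(gaussianReal b 1) :=
        lintegral_mono fun t => by
          rw [← ENNReal.ofReal_add (by positivity) (by positivity)]
          exact ENNReal.ofReal_le_ofReal (hpt _)
    _ = _ := lintegral_add_left (by fun_prop) _
    _ ≤ _ := add_le_add (setLIntegral_le_lintegral _ _) htail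

lemma gShiftRisk_add_le_adaptObj_mul {ρ : ℝ} (hρ : 0 < (ρ ^ 2)⁻¹ - 1) (δ : ℝ → ℝ) (b : ℝ) :
    gShiftRisk δ b + ENNReal.ofReal ((ρ ^ 2)⁻¹ - 1) ≤
      adaptObj ρ δ * (rBNM |b| + ENNReal.ofReal ((ρ ^ 2)⁻¹ - 1)) := by
  refine (ENNReal.div_le_iff ?_ ?_).1 (le_iSup (fun b : ℝ =>
    (gShiftRisk δ b + ENNReal.ofReal ((ρ ^ 2)⁻¹ - 1)) /
      (rBNM |b| + ENNReal.ofReal ((ρ ^ 2)⁻¹ - 1))) b)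
  · simp [-tsub_le_iff_right, hρ]
  · exact ENNReal.add_ne_top.2
      ⟨((rBNM_le_one _).trans_lt ENNReal.one_lt_top).ne, ENNReal.ofReal_ne_top⟩

lemma sq_mul_le_adaptObj_mul {ρ : ℝ} (hρ : 0 < (ρ ^ 2)⁻¹ - 1) {δ : ℝ → ℝ} (hδ : Measurable δ)
    {b x κ : ℝ} (hb : 0 ≤ b) (h0 : 0 < κ) :
    ENNReal.ofReal ((1 - κ) * b ^ 2) * gaussianReal 0 1 (Set.Iic x) ≤
      adaptObj ρ δ * ENNReal.ofReal (1 + ((ρ ^ 2)⁻¹ - 1) +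
        κ⁻¹ * Real.exp (b ^ 2 / 2 + b * x) * ((ρ ^ 2)⁻¹ - 1)) := by
  set e := (ρ ^ 2)⁻¹ - 1
  have hr0 : gShiftRisk δ 0 ≤ adaptObj ρ δ * ENNReal.ofReal e := by
    simpa [rBNM_zero] using le_self_add.trans (gShiftRisk_add_le_adaptObj_mul hρ δ 0)
  have hrb : gShiftRisk δ b ≤ adaptObj ρ δ * ENNReal.ofReal (1 + e) := by
    refine (le_self_add.trans (gShiftRisk_add_le_adaptObj_mul hρ δ b)).trans ?_
    rw [ENNReal.ofReal_add zero_le_one hρ.le, ENNReal.ofReal_one]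
    gcongr
    exact rBNM_le_one _
  refine (sq_mul_le_gShiftRisk_add hδ hb h0).trans ?_
  rw [ENNReal.ofReal_add (by positivity) (by positivity), mul_add,
    ENNReal.ofReal_mul (p := κ⁻¹ * _) (by positivity), mul_left_comm]
  gcongr

lemma tendsto_rho : Tendsto (fun ρ : ℝ => Real.log (((ρ ^ 2)⁻¹ - 1)⁻¹)) rhoFilter atTop ∧
    ∀ᶠ ρ : ℝ in rhoFilter, 0 < (ρ ^ 2)⁻¹ - 1 := by
  have hcont : Tendsto (fun y : ℝ => (y ^ 2)⁻¹ - 1) (𝓝[<] 1) (𝓝 0) := by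
    have : ContinuousAt (fun y : ℝ => (y ^ 2)⁻¹ - 1) 1 := by
      refine ContinuousAt.sub (ContinuousAt.inv₀ (by fun_prop) (by simp)) continuousAt_const
    simpa using this.tendsto.mono_left nhdsWithin_le_nhds
  have hpos : ∀ᶠ y : ℝ in 𝓝[<] 1, 0 < (y ^ 2)⁻¹ - 1 := by
    filter_upwards [Ioo_mem_nhdsLT (zero_lt_one (α := ℝ))] with y hy
    have : 1 < (y ^ 2)⁻¹ := (one_lt_inv₀ (by have := hy.1; positivity)).2
      (by nlinarith [hy.1, hy.2])
    linarith
  have habs : Tendsto (fun ρ : ℝ => |ρ|) rhoFilter (𝓝[<] 1) := tendsto_comap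
  have h0 : Tendsto (fun y : ℝ => (y ^ 2)⁻¹ - 1) (𝓝[<] 1) (𝓝[>] 0) :=
    tendsto_nhdsWithin_iff.2 ⟨hcont, hpos⟩
  constructor
  · have := (Real.tendsto_log_atTop.comp (tendsto_inv_nhdsGT_zero.comp h0)).comp habs
    simpa [Function.comp_def] using this
  · simpa using habs.eventually hpos

lemma eventually_two_point_factor_le {q : ℝ} (h0 : 0 < q) (h1 : q < 1) (x : ℝ) :
    ∀ᶠ L : ℝ in atTop, 1 + Real.exp (-L) +
      (1 - q)⁻¹ * Real.exp (√(2 * q * L) ^ 2 / 2 + √(2 * q * L) * x) * Real.exp (-L) ≤ q⁻¹ := by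
  have hη : 0 < 1 - q := by linarith
  have hlim : Tendsto (fun L : ℝ => 1 + Real.exp (-L) +
      (1 - q)⁻¹ * Real.exp (-((1 - q) / 2 * L))) atTop (𝓝 (1 + 0 + (1 - q)⁻¹ * 0)) :=
    (tendsto_const_nhds.add (Real.tendsto_exp_neg_atTop_nhds_zero)).add
      ((Real.tendsto_exp_neg_atTop_nhds_zero.comp
        (tendsto_id.const_mul_atTop (half_pos hη))).const_mul _)
  have hq : 1 + 0 + (1 - q)⁻¹ * 0 < q⁻¹ := by simpa using (one_lt_inv₀ h0).2 h1
  have hs : Tendsto (fun L : ℝ => √(2 * q * L)) atTop atTop :=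
    Real.tendsto_sqrt_atTop.comp (tendsto_id.const_mul_atTop (by positivity))
  filter_upwards [hlim.eventually (gt_mem_nhds hq), eventually_ge_atTop 0,
    hs.eventually_ge_atTop (4 * q * |x| / (1 - q))] with L hL hL0 hbig
  refine le_trans ?_ hL.le
  rw [mul_assoc, ← Real.exp_add]
  gcongr
  set b := √(2 * q * L)
  have hb2 : b ^ 2 = 2 * q * L := Real.sq_sqrt (by positivity)
  rw [div_le_iff₀ hη] at hbig
  have hb0 : 0 ≤ b := Real.sqrt_nonneg _
  have hx : b * x ≤ b * |x| := mul_le_mul_of_nonneg_left (le_abs_self x) hb0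
  have : 4 * q * (b * |x|) ≤ 4 * q * ((1 - q) / 2 * L) := by
    nlinarith [mul_le_mul_of_nonneg_right hbig hb0]
  have := le_of_mul_le_mul_left this (by positivity)
  linarith

lemma eventually_le_Astar {q : ℝ} (h0 : 0 < q) (h1 : q < 1) :
    ∀ᶠ ρ in rhoFilter, ENNReal.ofReal (q ^ 4) * denomLog ρ ≤ Astar ρ := by
  obtain ⟨x, -, hx⟩ := exists_lt_setLIntegral_Icc (ν := gaussianReal 0 1) (f := fun _ => 1)
    (c := ENNReal.ofReal q) (by simpa using h1)
  have hx' : ENNReal.ofReal q ≤ gaussianReal 0 1 (Set.Iic x) := by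
    simp only [lintegral_const, one_mul, Measure.restrict_apply_univ] at hx
    exact hx.le.trans (measure_mono Set.Icc_subset_Iic_self)
  filter_upwards [tendsto_rho.2, tendsto_rho.1.eventually (eventually_two_point_factor_le h0 h1 x),
    tendsto_rho.1.eventually_ge_atTop 0] with ρ hρ hfac hL0
  refine le_iInf fun ⟨δ, hδ⟩ => ?_
  set L := Real.log (((ρ ^ 2)⁻¹ - 1)⁻¹) with hL
  have he : Real.exp (-L) = (ρ ^ 2)⁻¹ - 1 := by
    rw [hL, Real.log_inv, neg_neg, Real.exp_log hρ]
  rw [he] at hfac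
  have h := sq_mul_le_adaptObj_mul hρ hδ (b := √(2 * q * L)) (x := x) (κ := 1 - q)
    (Real.sqrt_nonneg _) (by linarith)
  rw [sub_sub_cancel, Real.sq_sqrt (by positivity)] at h
  rw [Real.sq_sqrt (by positivity)] at hfac
  have h2 : ENNReal.ofReal (q * (2 * q * L)) * ENNReal.ofReal q ≤
      adaptObj ρ δ * ENNReal.ofReal q⁻¹ :=
    (mul_le_mul_right hx' _).trans (h.trans (mul_le_mul_right (ENNReal.ofReal_le_ofReal hfac) _))
  calc ENNReal.ofReal (q ^ 4) * denomLog ρ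
      = ENNReal.ofReal (q * (2 * q * L)) * ENNReal.ofReal q * ENNReal.ofReal q := by
        rw [denomLog, ← hL, ← ENNReal.ofReal_mul (by positivity), ← ENNReal.ofReal_mul (by positivity),
          ← ENNReal.ofReal_mul (by positivity)]
        ring_nf
    _ ≤ adaptObj ρ δ * ENNReal.ofReal q⁻¹ * ENNReal.ofReal q := by gcongr
    _ = adaptObj ρ δ := by
        rw [mul_assoc, ← ENNReal.ofReal_mul (by positivity), inv_mul_cancel₀ h0.ne']
        simp

/-- The features shared by soft and hard thresholding at level `l`. -/
structure IsThresholdRule (l : ℝ) (δ : ℝ → ℝ) : Prop where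
  measurable : Measurable δ
  eq_zero : ∀ t, |t| ≤ l → δ t = 0
  abs_sub_le : ∀ t, |δ t - t| ≤ l
  sq_le : ∀ t b, (δ t - b) ^ 2 ≤ b ^ 2 + (t - b) ^ 2

lemma isThresholdRule_hardThresh {l : ℝ} (hl : 0 ≤ l) : IsThresholdRule l (hardThresh l) where
  measurable := Measurable.ite (measurableSet_lt measurable_const measurable_id.abs)
    measurable_id measurable_const
  eq_zero t ht := by simp [hardThresh, ht.not_gt]
  abs_sub_le t := by
    unfold hardThresh
    split_ifs with h
    · simpa using hl
    · simpa using h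
  sq_le t b := by
    unfold hardThresh
    split_ifs <;> nlinarith [sq_nonneg b, sq_nonneg (t - b)]

lemma isThresholdRule_softThresh {l : ℝ} (hl : 0 ≤ l) : IsThresholdRule l (softThresh l) where
  measurable := by
    have hs : Measurable Real.sign := by
      unfold Real.sign
      exact Measurable.ite measurableSet_Iio measurable_const
        (Measurable.ite measurableSet_Ioi measurable_const measurable_const)
    unfold softThresh
    fun_prop
  eq_zero t ht := by simp [softThresh, ht]
  abs_sub_le t := by
    unfold softThresh
    rw [abs_le]
    rcases lt_trichotomy t 0 with h | rfl | h
    · rw [Real.sign_of_neg h, abs_of_neg h]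
      rcases max_cases (-t - l) 0 with ⟨h1, _⟩ | ⟨h1, _⟩ <;> rw [h1] <;>
        constructor <;> linarith
    · simp [hl]
    · rw [Real.sign_of_pos h, abs_of_pos h]
      rcases max_cases (t - l) 0 with ⟨h1, _⟩ | ⟨h1, _⟩ <;> rw [h1] <;>
        constructor <;> linarith
  sq_le t b := by
    have key : ∀ d t b : ℝ, 0 ≤ d → d ≤ t → (d - b) ^ 2 ≤ b ^ 2 + (t - b) ^ 2 := by
      intro d t b h0 h1
      rcases le_total b d with h | h <;> nlinarith
    unfold softThresh
    rcases lt_trichotomy t 0 with h | rfl | h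
    · rw [Real.sign_of_neg h, abs_of_neg h]
      have := key (max (-t - l) 0) (-t) (-b) (le_max_right _ _)
        (max_le (by linarith) (by linarith))
      nlinarith
    · simp [sq_nonneg]
    · rw [Real.sign_of_pos h, abs_of_pos h, one_mul]
      exact key _ _ _ (le_max_right _ _) (max_le (by linarith) h.le)

lemma IsThresholdRule.gShiftRisk_le {l : ℝ} (hl : 0 ≤ l) {δ : ℝ → ℝ} (hδ : IsThresholdRule l δ)
    (b : ℝ) : gShiftRisk δ b ≤ ENNReal.ofReal ((1 + l) ^ 2) := by
  have hpt : ∀ t, (δ t - b) ^ 2 ≤ (1 + l) * (t - b) ^ 2 + (1 + l) * l := fun t => by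
    have h := sq_le_sq' (abs_le.1 (hδ.abs_sub_le t)).1 (abs_le.1 (hδ.abs_sub_le t)).2
    rcases hl.eq_or_lt with rfl | hpos
    · have : δ t = t := by simpa [sub_eq_zero] using hδ.abs_sub_le t
      simp [this]
    · have e : l * ((1 + l) * (t - b) ^ 2 + (1 + l) * l - (δ t - b) ^ 2) =
          (l * (t - b) - (δ t - t)) ^ 2 + (1 + l) * (l ^ 2 - (δ t - t) ^ 2) := by ring
      have : 0 ≤ l * ((1 + l) * (t - b) ^ 2 + (1 + l) * l - (δ t - b) ^ 2) := by
        rw [e]; have : 0 ≤ l ^ 2 - (δ t - t) ^ 2 := by linarith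
        positivity
      linarith [nonneg_of_mul_nonneg_right this hpos]
  calc gShiftRisk δ b ≤ ∫⁻ t, (ENNReal.ofReal (1 + l) * ENNReal.ofReal ((t - b) ^ 2) +
          ENNReal.ofReal ((1 + l) * l)) ∂(gaussianReal b 1) := by
        refine lintegral_mono fun t => ?_
        rw [← ENNReal.ofReal_mul (by positivity),
          ← ENNReal.ofReal_add (by positivity) (by positivity)]
        exact ENNReal.ofReal_le_ofReal (hpt t)
    _ = ENNReal.ofReal (1 + l) + ENNReal.ofReal ((1 + l) * l) := by
        rw [lintegral_add_right _ measurable_const, lintegral_const_mul _ (by fun_prop)]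
        have := gShiftRisk_id b
        unfold gShiftRisk at this
        simp [this]
    _ = ENNReal.ofReal ((1 + l) ^ 2) := by
        rw [← ENNReal.ofReal_add (by positivity) (by positivity)]
        ring_nf

lemma lintegral_sq_mul_exp_gaussianReal_lt_top {s : ℝ} (hs : s < 1) :
    ∫⁻ z, ENNReal.ofReal (z ^ 2 * Real.exp (s * z ^ 2 / 2)) ∂(gaussianReal 0 1) < ⊤ := by
  have hint := (integrable_rpow_mul_exp_neg_mul_sq (b := (1 - s) / 2) (by linarith)
    (s := 2) (by norm_num)).const_mul (√(2 * Real.pi))⁻¹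
  rw [lintegral_gaussianReal_eq_pdf 0 (by fun_prop)]
  refine lt_of_le_of_lt (le_of_eq (lintegral_congr fun z => ?_)) hint.lintegral_lt_top
  rw [← ENNReal.ofReal_mul (by positivity), Real.rpow_two, mul_assoc, mul_left_comm (Real.exp _),
    ← Real.exp_add]
  ring_nf

lemma IsThresholdRule.gShiftRisk_le_near {l K s : ℝ} (hs : 0 ≤ s) {δ : ℝ → ℝ}
    (hδ : IsThresholdRule l δ) (hKl : K ≤ l) {b : ℝ} (hb : |b| ≤ K) :
    gShiftRisk δ b ≤ ENNReal.ofReal (b ^ 2) +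
      (∫⁻ z, ENNReal.ofReal (z ^ 2 * Real.exp (s * z ^ 2 / 2)) ∂(gaussianReal 0 1)) *
        ENNReal.ofReal (Real.exp (-(s * (l - K) ^ 2 / 2))) := by
  have hpt : ∀ t, (δ t - b) ^ 2 ≤ b ^ 2 +
      (t - b) ^ 2 * Real.exp (s * (t - b) ^ 2 / 2) * Real.exp (-(s * (l - K) ^ 2 / 2)) := by
    intro t
    rcases le_or_gt |t| l with ht | ht
    · rw [hδ.eq_zero t ht]
      have : 0 ≤ (t - b) ^ 2 * Real.exp (s * (t - b) ^ 2 / 2) *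
        Real.exp (-(s * (l - K) ^ 2 / 2)) := by positivity
      linarith
    · refine (hδ.sq_le t b).trans ?_
      rw [mul_assoc, ← Real.exp_add]
      have habs : l - K ≤ |t - b| := by linarith [abs_sub_abs_le_abs_sub t b]
      have hsq : (l - K) ^ 2 ≤ (t - b) ^ 2 := by
        rw [← sq_abs (t - b)]
        exact pow_le_pow_left₀ (by linarith) habs 2
      have : 1 ≤ Real.exp (s * (t - b) ^ 2 / 2 + -(s * (l - K) ^ 2 / 2)) :=
        Real.one_le_exp (by nlinarith)
      nlinarith [sq_nonneg (t - b)]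
  calc gShiftRisk δ b ≤ ∫⁻ t, (ENNReal.ofReal (b ^ 2) +
          ENNReal.ofReal ((t - b) ^ 2 * Real.exp (s * (t - b) ^ 2 / 2)) *
            ENNReal.ofReal (Real.exp (-(s * (l - K) ^ 2 / 2)))) ∂(gaussianReal b 1) := by
        refine lintegral_mono fun t => ?_
        rw [← ENNReal.ofReal_mul (by positivity),
          ← ENNReal.ofReal_add (by positivity) (by positivity)]
        exact ENNReal.ofReal_le_ofReal (hpt t)
    _ = _ := by
        rw [lintegral_add_left measurable_const, lintegral_mul_const _ (by fun_prop),
          lintegral_gaussianReal_comp_sub b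
            (f := fun z => ENNReal.ofReal (z ^ 2 * Real.exp (s * z ^ 2 / 2))) (by fun_prop)]
        simp

lemma eventually_threshold_conditions {q : ℝ} (hq : 1 < q) (K D : ℝ) :
    ∀ᶠ l : ℝ in atTop, 0 ≤ l ∧ K ≤ l ∧ q⁻¹ * l ^ 2 ≤ (l - K) ^ 2 ∧
      (1 + l) ^ 2 + 1 ≤ q * l ^ 2 ∧ D ≤ q ^ 2 * l ^ 2 := by
  have hq' : 0 < 1 - q⁻¹ := by
    have := inv_lt_one_of_one_lt₀ hq
    linarith
  filter_upwards [eventually_ge_atTop 1, eventually_ge_atTop K,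
    eventually_ge_atTop (2 * K / (1 - q⁻¹)), eventually_ge_atTop (4 / (q - 1)),
    eventually_ge_atTop D] with l h1 hK hK2 h4 hD
  rw [div_le_iff₀ (by linarith)] at hK2 h4
  refine ⟨by linarith, hK, ?_, ?_, ?_⟩
  · nlinarith [mul_le_mul_of_nonneg_right hK2 (by linarith : 0 ≤ l), sq_nonneg K]
  · nlinarith [mul_le_mul_of_nonneg_right h4 (by linarith : 0 ≤ l)]
  · have : l ≤ l ^ 2 := by nlinarith
    have : l ^ 2 ≤ q ^ 2 * l ^ 2 := by nlinarith [sq_nonneg l, mul_pos (sub_pos.2 hq) (sub_pos.2 hq)]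
    linarith

/-- Uniformly over threshold rules at level `q √(2 L)`, the adaptation objective is `≤ q⁴ · 2L`. -/
lemma eventually_adaptObj_le {q : ℝ} (hq : 1 < q) :
    ∀ᶠ ρ in rhoFilter, ∃ l : ℝ, 0 ≤ l ∧ ∀ δ : ℝ → ℝ, IsThresholdRule l δ →
      adaptObj ρ δ ≤ ENNReal.ofReal (q ^ 4) * denomLog ρ := by
  have hq0 : 0 < q := by linarith
  have hinv : q⁻¹ < 1 := inv_lt_one_of_one_lt₀ hq
  obtain ⟨K, hK0, hK⟩ := exists_le_rBNM (inv_pos.2 hq0) hinv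
  obtain ⟨m, hm, hmK⟩ := exists_mul_sq_le_rBNM K
  set C := ∫⁻ z, ENNReal.ofReal (z ^ 2 * Real.exp (q⁻¹ * z ^ 2 / 2)) ∂(gaussianReal 0 1)
  have hCtop : C ≠ ⊤ := (lintegral_sq_mul_exp_gaussianReal_lt_top hinv).ne
  set D : ℝ := m⁻¹ + C.toReal + 1 with hD
  have hlim : Tendsto (fun ρ : ℝ => q * √(2 * Real.log (((ρ ^ 2)⁻¹ - 1)⁻¹))) rhoFilter atTop :=
    (Real.tendsto_sqrt_atTop.comp (tendsto_rho.1.const_mul_atTop two_pos)).const_mul_atTop hq0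
  filter_upwards [tendsto_rho.2, tendsto_rho.1.eventually_ge_atTop 0,
    hlim.eventually (eventually_threshold_conditions hq K D)] with ρ hρ hL0 hl
  set L := Real.log (((ρ ^ 2)⁻¹ - 1)⁻¹) with hL
  set l := q * √(2 * L) with hldef
  set e := (ρ ^ 2)⁻¹ - 1 with he
  have hexp : Real.exp (-L) = e := by rw [hL, Real.log_inv, neg_neg, Real.exp_log hρ]
  have he1 : e ≤ 1 := by rw [← hexp]; exact Real.exp_le_one_iff.2 (by linarith)
  have hl2 : l ^ 2 = q ^ 2 * (2 * L) := by rw [hldef, mul_pow, Real.sq_sqrt (by positivity)]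
  obtain ⟨hl0, hKl, hc1, hc2, hc3⟩ := hl
  refine ⟨l, hl0, fun δ hδ => iSup_le fun b => ENNReal.div_le_of_le_mul ?_⟩
  have hB : ENNReal.ofReal (q ^ 4) * denomLog ρ = ENNReal.ofReal (q ^ 2 * l ^ 2) := by
    rw [denomLog, ← he, ← hL, ← ENNReal.ofReal_mul (by positivity), hl2]
    ring_nf
  rw [hB]
  rcases le_total |b| K with hb | hb
  · have hnear := hδ.gShiftRisk_le_near (inv_nonneg.2 hq0.le) hKl hb
    have hexp_le : Real.exp (-(q⁻¹ * (l - K) ^ 2 / 2)) ≤ e := by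
      rw [← hexp, Real.exp_le_exp, neg_le_neg_iff]
      have := mul_le_mul_of_nonneg_left hc1 (inv_nonneg.2 hq0.le)
      have e2 : q⁻¹ * (q⁻¹ * l ^ 2) = 2 * L := by rw [hl2]; field_simp
      linarith
    calc gShiftRisk δ b + ENNReal.ofReal e
        ≤ ENNReal.ofReal (b ^ 2) + C * ENNReal.ofReal e + ENNReal.ofReal e := by
          refine add_le_add (hnear.trans ?_) le_rfl
          gcongr
      _ = ENNReal.ofReal (b ^ 2 + C.toReal * e + e) := by
          rw [ENNReal.ofReal_add (by positivity) hρ.le,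
            ENNReal.ofReal_add (by positivity) (by positivity),
            ENNReal.ofReal_mul ENNReal.toReal_nonneg, ENNReal.ofReal_toReal hCtop]
      _ ≤ ENNReal.ofReal (q ^ 2 * l ^ 2 * (m * |b| ^ 2 + e)) := by
          refine ENNReal.ofReal_le_ofReal ?_
          rw [sq_abs]
          have hmm : m⁻¹ * m = 1 := inv_mul_cancel₀ hm.ne'
          calc b ^ 2 + C.toReal * e + e ≤ D * (m * b ^ 2 + e) := by
                have h1 : 0 ≤ (C.toReal + 1) * (m * b ^ 2) := by positivity
                have h2 : 0 ≤ m⁻¹ * e := by positivity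
                have h3 : m⁻¹ * (m * b ^ 2) = b ^ 2 := by rw [← mul_assoc, hmm, one_mul]
                rw [hD]
                nlinarith
            _ ≤ _ := by gcongr
      _ = ENNReal.ofReal (q ^ 2 * l ^ 2) * (ENNReal.ofReal (m * |b| ^ 2) + ENNReal.ofReal e) := by
          rw [ENNReal.ofReal_mul (by positivity), ENNReal.ofReal_add (by positivity) hρ.le]
      _ ≤ _ := by
          gcongr
          exact hmK _ (abs_nonneg b) hb
  · calc gShiftRisk δ b + ENNReal.ofReal e
        ≤ ENNReal.ofReal ((1 + l) ^ 2) + ENNReal.ofReal e :=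
          add_le_add (hδ.gShiftRisk_le hl0 b) le_rfl
      _ = ENNReal.ofReal ((1 + l) ^ 2 + e) := (ENNReal.ofReal_add (by positivity) hρ.le).symm
      _ ≤ ENNReal.ofReal (q ^ 2 * l ^ 2 * q⁻¹) := by
          refine ENNReal.ofReal_le_ofReal ?_
          have : q ^ 2 * l ^ 2 * q⁻¹ = q * l ^ 2 := by field_simp
          linarith
      _ = ENNReal.ofReal (q ^ 2 * l ^ 2) * ENNReal.ofReal q⁻¹ :=
          ENNReal.ofReal_mul (by positivity)
      _ ≤ _ := by
          gcongr
          exact (hK.trans (rBNM_mono hb)).trans le_self_add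

/-- Squeeze criterion for `F / D → 1` up to multiplicative factors `q⁴` with `q` close to `1`. -/
lemma tendsto_div_one_of_pow_four_bounds {α : Type*} {f : Filter α} {F D : α → ℝ≥0∞}
    (hD : ∀ᶠ a in f, D a ≠ 0 ∧ D a ≠ ⊤)
    (hlow : ∀ q : ℝ, 0 < q → q < 1 → ∀ᶠ a in f, ENNReal.ofReal (q ^ 4) * D a ≤ F a)
    (hup : ∀ q : ℝ, 1 < q → ∀ᶠ a in f, F a ≤ ENNReal.ofReal (q ^ 4) * D a) :
    Tendsto (fun a => F a / D a) f (𝓝 1) := by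
  have hcont : Tendsto (fun q : ℝ => ENNReal.ofReal (q ^ 4)) (𝓝 1) (𝓝 1) := by
    have : Continuous fun q : ℝ => ENNReal.ofReal (q ^ 4) :=
      ENNReal.continuous_ofReal.comp (by fun_prop)
    simpa using this.tendsto 1
  refine tendsto_order.2 ⟨fun c hc => ?_, fun c hc => ?_⟩
  · obtain ⟨q, hcq, hq⟩ := (((hcont.mono_left nhdsWithin_le_nhds).eventually
      (lt_mem_nhds hc)).and (Ioo_mem_nhdsLT (zero_lt_one (α := ℝ)))).exists
    filter_upwards [hD, hlow q hq.1 hq.2] with a ha h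
    exact hcq.trans_le ((ENNReal.le_div_iff_mul_le (Or.inl ha.1) (Or.inl ha.2)).2 h)
  · obtain ⟨q, hcq, hq⟩ := (((hcont.mono_left nhdsWithin_le_nhds).eventually
      (gt_mem_nhds hc)).and (self_mem_nhdsWithin (s := Set.Ioi (1 : ℝ)))).exists
    filter_upwards [hup q hq] with a h
    exact (ENNReal.div_le_of_le_mul h).trans_lt hcq

lemma eventually_denomLog_ne : ∀ᶠ ρ in rhoFilter, denomLog ρ ≠ 0 ∧ denomLog ρ ≠ ⊤ := by
  filter_upwards [tendsto_rho.1.eventually_gt_atTop 0] with ρ hρ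
  exact ⟨(ENNReal.ofReal_pos.2 (by positivity)).ne', ENNReal.ofReal_ne_top⟩

lemma Astar_le_AstarS (ρ : ℝ) : Astar ρ ≤ AstarS ρ :=
  le_iInf₂ fun l hl => iInf_le (fun δ : {f : ℝ → ℝ // Measurable f} => adaptObj ρ δ)
    ⟨softThresh l, (isThresholdRule_softThresh hl).measurable⟩

lemma Astar_le_AstarH (ρ : ℝ) : Astar ρ ≤ AstarH ρ :=
  le_iInf₂ fun l hl => iInf_le (fun δ : {f : ℝ → ℝ // Measurable f} => adaptObj ρ δ)
    ⟨hardThresh l, (isThresholdRule_hardThresh hl).measurable⟩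

lemma eventually_AstarS_le {q : ℝ} (hq : 1 < q) :
    ∀ᶠ ρ in rhoFilter, AstarS ρ ≤ ENNReal.ofReal (q ^ 4) * denomLog ρ := by
  filter_upwards [eventually_adaptObj_le hq] with ρ ⟨l, hl, h⟩
  exact (iInf₂_le l hl).trans (h _ (isThresholdRule_softThresh hl))

lemma eventually_AstarH_le {q : ℝ} (hq : 1 < q) :
    ∀ᶠ ρ in rhoFilter, AstarH ρ ≤ ENNReal.ofReal (q ^ 4) * denomLog ρ := by
  filter_upwards [eventually_adaptObj_le hq] with ρ ⟨l, hl, h⟩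
  exact (iInf₂_le l hl).trans (h _ (isThresholdRule_hardThresh hl))

/-- **Asymptotics of the loss of efficiency under adaptation as `|ρ| → 1`.**
Each of `A*(ρ)`, `A*_S(ρ)` and `A*_H(ρ)`, divided by `2·log((ρ⁻² − 1)⁻¹)`, converges
to `1` as `|ρ| ↑ 1`. -/
theorem stmt_9 :
    Tendsto (fun ρ : ℝ => Astar ρ / denomLog ρ) rhoFilter (𝓝 (1 : ℝ≥0∞)) ∧
    Tendsto (fun ρ : ℝ => AstarS ρ / denomLog ρ) rhoFilter (𝓝 (1 : ℝ≥0∞)) ∧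
    Tendsto (fun ρ : ℝ => AstarH ρ / denomLog ρ) rhoFilter (𝓝 (1 : ℝ≥0∞)) := by
  refine ⟨tendsto_div_one_of_pow_four_bounds eventually_denomLog_ne
      (fun q h0 h1 => eventually_le_Astar h0 h1)
      (fun q hq => (eventually_AstarS_le hq).mono fun ρ h => (Astar_le_AstarS ρ).trans h),
    tendsto_div_one_of_pow_four_bounds eventually_denomLog_ne
      (fun q h0 h1 => (eventually_le_Astar h0 h1).mono fun ρ h => h.trans (Astar_le_AstarS ρ))
      (fun q hq => eventually_AstarS_le hq),
    tendsto_div_one_of_pow_four_bounds eventually_denomLog_ne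
      (fun q h0 h1 => (eventually_le_Astar h0 h1).mono fun ρ h => h.trans (Astar_le_AstarH ρ))
      (fun q hq => eventually_AstarH_le hq)⟩
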